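/- Let P be an SQLP(R,D) program and T_R(P) its transformed QLP(D) program. Then for every atom A in P's signature and every d ∈ D ∖ {⊥}: P ⊢_{SQHL(R,D)} A#d if and only if T_R(P) ⊢_{QHL(D)} A#d. Consequently the least Herbrand model of T_R(P), restricted to atoms of P's signature, coincides with the least Herbrand model of P. -/

import Mathlib

structure QualDom (D : Type*) [Lattice D] [BoundedOrder D] where
  att : D → D → D
  att_assoc : ∀ a b c : D, att (att a b) c = att a (att b c)
  att_comm : ∀ a b : D, att a b = att b a
  att_mono : ∀ a b c d : D, a ≤ b → c ≤ d → att a c ≤ att b d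
  att_top : ∀ a : D, att a ⊤ = a
  att_bot : ∀ a : D, att a ⊥ = ⊥
  att_strict : ∀ a b : D, a ≠ ⊥ → a ≠ ⊤ → b ≠ ⊥ → b ≠ ⊤ → att a b < b
  att_distrib_inf : ∀ a b c : D, att a (b ⊓ c) = att a b ⊓ att a c

mutual
  inductive Term (C : Type) (ar : C → ℕ) : Type where
    | var : ℕ → Term C ar
    | app : (c : C) → TermVec C ar (ar c) → Term C ar
  inductive TermVec (C : Type) (ar : C → ℕ) : ℕ → Type where
    | nil : TermVec C ar 0
    | cons {n : ℕ} : Term C ar → TermVec C ar n → TermVec C ar (n + 1)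
end

def Subst (C : Type) (ar : C → ℕ) : Type := ℕ → Term C ar

mutual
  def Term.subst {C : Type} {ar : C → ℕ} : Term C ar → Subst C ar → Term C ar
    | .var i, θ => θ i
    | .app c ts, θ => .app c (ts.subst θ)
  def TermVec.subst {C : Type} {ar : C → ℕ} :
      ∀ {n : ℕ}, TermVec C ar n → Subst C ar → TermVec C ar n
    | _, .nil, _ => .nil
    | _, .cons t ts, θ => .cons (t.subst θ) (ts.subst θ)
end

structure Atom (C Pd : Type) (ar : C → ℕ) (par : Pd → ℕ) : Type where
  pred : Pd
  args : TermVec C ar (par pred)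

def Atom.subst {C Pd : Type} {ar : C → ℕ} {par : Pd → ℕ}
    (A : Atom C Pd ar par) (θ : Subst C ar) : Atom C Pd ar par :=
  ⟨A.pred, A.args.subst θ⟩

structure SimRel (C Pd : Type) (ar : C → ℕ) (par : Pd → ℕ) (D : Type)
    [Lattice D] [BoundedOrder D] where
  simC : C → C → D
  simP : Pd → Pd → D
  simC_refl : ∀ c, simC c c = ⊤
  simC_symm : ∀ c c', simC c c' = simC c' c
  simC_trans : ∀ c c' c'', simC c c' ⊓ simC c' c'' ≤ simC c c''
  simP_refl : ∀ p, simP p p = ⊤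
  simP_symm : ∀ p p', simP p p' = simP p' p
  simP_trans : ∀ p p' p'', simP p p' ⊓ simP p' p'' ≤ simP p p''
  simC_arity : ∀ c c', simC c c' ≠ ⊥ → ar c = ar c'
  simP_arity : ∀ p p', simP p p' ≠ ⊥ → par p = par p'

variable {C Pd : Type} {ar : C → ℕ} {par : Pd → ℕ} {D : Type} [Lattice D] [BoundedOrder D]

mutual
  def termSim (R : SimRel C Pd ar par D) : Term C ar → Term C ar → D
    | .var i, .var j => if i = j then ⊤ else ⊥
    | .app c ts, .app c' ts' => R.simC c c' ⊓ vecSim R ts ts'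
    | _, _ => ⊥
  def vecSim (R : SimRel C Pd ar par D) :
      ∀ {n m : ℕ}, TermVec C ar n → TermVec C ar m → D
    | _, _, .nil, .nil => ⊤
    | _, _, .cons t ts, .cons s ss => termSim R t s ⊓ vecSim R ts ss
    | _, _, _, _ => ⊥
end

def atomSim (R : SimRel C Pd ar par D) (A A' : Atom C Pd ar par) : D :=
  R.simP A.pred A'.pred ⊓ vecSim R A.args A'.args

mutual
  def Term.maxVar {C : Type} {ar : C → ℕ} : Term C ar → ℕ
    | .var i => i + 1
    | .app _ ts => ts.maxVar
  def TermVec.maxVar {C : Type} {ar : C → ℕ} : ∀ {n : ℕ}, TermVec C ar n → ℕ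
    | _, .nil => 0
    | _, .cons t ts => max t.maxVar ts.maxVar
end

mutual
  def linTerm {C : Type} {ar : C → ℕ} :
      Term C ar → List ℕ → ℕ → Term C ar × List ℕ × ℕ × List (ℕ × ℕ)
    | .var x, seen, fresh =>
        if x ∈ seen then (.var fresh, seen, fresh + 1, [(x, fresh)])
        else (.var x, x :: seen, fresh, [])
    | .app c ts, seen, fresh =>
        let r := linVec ts seen fresh
        (.app c r.1, r.2.1, r.2.2.1, r.2.2.2)
  def linVec {C : Type} {ar : C → ℕ} :
      ∀ {n : ℕ}, TermVec C ar n → List ℕ → ℕ → TermVec C ar n × List ℕ × ℕ × List (ℕ × ℕ)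
    | _, .nil, seen, fresh => (.nil, seen, fresh, [])
    | _, .cons t ts, seen, fresh =>
        let r1 := linTerm t seen fresh
        let r2 := linVec ts r1.2.1 r1.2.2.1
        (.cons r1.1 r2.1, r2.2.1, r2.2.2.1, r1.2.2.2 ++ r2.2.2.2)
end

def linAtomFrom (A : Atom C Pd ar par) (start : ℕ) : Atom C Pd ar par × List (ℕ × ℕ) :=
  let r := linVec A.args [] start
  (⟨A.pred, r.1⟩, r.2.2.2)

def linAtom (A : Atom C Pd ar par) : Atom C Pd ar par × List (ℕ × ℕ) :=
  linAtomFrom A A.args.maxVar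

def infList (l : List D) : D := l.foldr (· ⊓ ·) ⊤

def condsInf (R : SimRel C Pd ar par D) (θ : Subst C ar) (conds : List (ℕ × ℕ)) : D :=
  infList (conds.map fun p => termSim R (θ p.1) (θ p.2))

def RInstAtom (R : SimRel C Pd ar par D) (A A' : Atom C Pd ar par) (δ : D) : Prop :=
  ∃ (As : Atom C Pd ar par) (θ : Subst C ar),
    A' = As.subst θ ∧
    δ = atomSim R (linAtom A).1 As ⊓ condsInf R θ (linAtom A).2 ∧
    δ ≠ ⊥

structure Clause (C Pd : Type) (ar : C → ℕ) (par : Pd → ℕ) (D : Type) : Type where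
  head : Atom C Pd ar par
  att : D
  body : List (Atom C Pd ar par)

def Clause.maxVar (Cl : Clause C Pd ar par D) : ℕ :=
  max Cl.head.args.maxVar (Cl.body.foldr (fun B m => max B.args.maxVar m) 0)

def Clause.linHead (Cl : Clause C Pd ar par D) : Atom C Pd ar par × List (ℕ × ℕ) :=
  linAtomFrom Cl.head Cl.maxVar

def RInstClause (R : SimRel C Pd ar par D) (Cl Cl' : Clause C Pd ar par D) (δ : D) : Prop :=
  ∃ (As : Atom C Pd ar par) (θ : Subst C ar),
    δ = atomSim R Cl.linHead.1 As ⊓ condsInf R θ Cl.linHead.2 ∧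
    δ ≠ ⊥ ∧
    Cl' = ⟨As.subst θ, Cl.att, Cl.body.map (Atom.subst · θ)⟩

def entailsD (A : Atom C Pd ar par) (d : D) (A' : Atom C Pd ar par) (d' : D) : Prop :=
  ∃ θ : Subst C ar, A' = A.subst θ ∧ d' ≤ d

def entailsRD (R : SimRel C Pd ar par D) (Q : QualDom D) (A : Atom C Pd ar par) (d : D)
    (A' : Atom C Pd ar par) (d' : D) : Prop :=
  ∃ δ : D, RInstAtom R A A' δ ∧ d' ≤ Q.att d δ

def QAtom (C Pd : Type) (ar : C → ℕ) (par : Pd → ℕ) (D : Type)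
    [Lattice D] [BoundedOrder D] : Type :=
  {p : Atom C Pd ar par × D // p.2 ≠ ⊥}

def IsInterp (R : SimRel C Pd ar par D) (Q : QualDom D)
    (I : Set (QAtom C Pd ar par D)) : Prop :=
  ∀ a ∈ I, ∀ b : QAtom C Pd ar par D, entailsRD R Q a.1.1 a.1.2 b.1.1 b.1.2 → b ∈ I

def memQ (I : Set (QAtom C Pd ar par D)) (A : Atom C Pd ar par) (d : D) : Prop :=
  ∃ q ∈ I, q.1 = (A, d)

inductive SQHL (R : SimRel C Pd ar par D) (Q : QualDom D)
    (Pr : List (Clause C Pd ar par D)) : Atom C Pd ar par → D → Prop where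
  | mp (Cl : Clause C Pd ar par D) (hCl : Cl ∈ Pr) (Cl' : Clause C Pd ar par D) (δ : D)
      (ds : List D) (d' : D)
      (hinst : RInstClause R Cl Cl' δ)
      (hlen : ds.length = Cl'.body.length)
      (hprem : ∀ (i : ℕ) (h1 : i < Cl'.body.length) (h2 : i < ds.length),
        SQHL R Q Pr (Cl'.body.get ⟨i, h1⟩) (ds.get ⟨i, h2⟩))
      (hd' : d' ≠ ⊥)
      (hle : d' ≤ Q.att Cl.att (δ ⊓ infList ds)) :
      SQHL R Q Pr Cl'.head d'

def IsClauseModel (R : SimRel C Pd ar par D) (Q : QualDom D)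
    (I : Set (QAtom C Pd ar par D)) (Cl : Clause C Pd ar par D) : Prop :=
  ∀ (Cl' : Clause C Pd ar par D) (δ : D), RInstClause R Cl Cl' δ →
    ∀ ds : List D, ds.length = Cl'.body.length →
      (∀ (i : ℕ) (h1 : i < Cl'.body.length) (h2 : i < ds.length),
        memQ I (Cl'.body.get ⟨i, h1⟩) (ds.get ⟨i, h2⟩)) →
      ∀ e : D, e = Q.att Cl.att (δ ⊓ infList ds) → e ≠ ⊥ → memQ I Cl'.head e

def IsModel (R : SimRel C Pd ar par D) (Q : QualDom D)
    (Pr : List (Clause C Pd ar par D)) (I : Set (QAtom C Pd ar par D)) : Prop :=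
  ∀ Cl ∈ Pr, IsClauseModel R Q I Cl

def ExtP (Pd : Type) (D : Type) : Type := Pd ⊕ Unit ⊕ D

def extPar (par : Pd → ℕ) (D : Type) : ExtP Pd D → ℕ :=
  Sum.elim par (Sum.elim (fun _ => 2) (fun _ => 0))

def Atom.embed (A : Atom C Pd ar par) : Atom C (ExtP Pd D) ar (extPar par D) :=
  ⟨Sum.inl A.pred, A.args⟩

def simAtom (t s : Term C ar) : Atom C (ExtP Pd D) ar (extPar par D) :=
  ⟨Sum.inr (Sum.inl ()), .cons t (.cons s .nil)⟩

def payAtom (w : D) : Atom C (ExtP Pd D) ar (extPar par D) :=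
  ⟨Sum.inr (Sum.inr w), .nil⟩

def condAtoms (conds : List (ℕ × ℕ)) : List (Atom C (ExtP Pd D) ar (extPar par D)) :=
  conds.map fun p => simAtom (.var p.1) (.var p.2)

def varVec (C : Type) (ar : C → ℕ) : ℕ → (n : ℕ) → TermVec C ar n
  | _, 0 => .nil
  | start, n + 1 => .cons (.var start) (varVec C ar (start + 1) n)

def simConds (n : ℕ) : List (Atom C (ExtP Pd D) ar (extPar par D)) :=
  (List.range n).map fun i => simAtom (.var i) (.var (n + i))

def transPS (R : SimRel C Pd ar par D) (Pr : List (Clause C Pd ar par D)) :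
    Set (Clause C (ExtP Pd D) ar (extPar par D) D) :=
  {Cl' | ∃ Cl ∈ Pr, ∃ H' : Atom C Pd ar par,
    atomSim R (Clause.linHead Cl).1 H' ≠ ⊥ ∧
    Cl' = ⟨Atom.embed H', Cl.att,
      payAtom (atomSim R (Clause.linHead Cl).1 H') ::
        (condAtoms (Clause.linHead Cl).2 ++ Cl.body.map Atom.embed)⟩}

def transSim (R : SimRel C Pd ar par D) :
    Set (Clause C (ExtP Pd D) ar (extPar par D) D) :=
  {⟨simAtom (.var 0) (.var 0), ⊤, []⟩} ∪
  {Cl' | ∃ c c' : C, R.simC c c' ≠ ⊥ ∧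
    Cl' = ⟨simAtom (.app c (varVec C ar 0 (ar c))) (.app c' (varVec C ar (ar c) (ar c'))), ⊤,
           payAtom (R.simC c c') :: simConds (ar c)⟩}

def payWeights (R : SimRel C Pd ar par D) (Pr : List (Clause C Pd ar par D)) : Set D :=
  {w | ∃ Cl ∈ Pr, ∃ H' : Atom C Pd ar par,
      atomSim R (Clause.linHead Cl).1 H' ≠ ⊥ ∧ w = atomSim R (Clause.linHead Cl).1 H'} ∪
  {w | ∃ c c' : C, R.simC c c' ≠ ⊥ ∧ w = R.simC c c'}

def transPay (R : SimRel C Pd ar par D) (Pr : List (Clause C Pd ar par D)) :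
    Set (Clause C (ExtP Pd D) ar (extPar par D) D) :=
  {Cl' | ∃ w ∈ payWeights R Pr, Cl' = ⟨payAtom w, w, []⟩}

def transProg (R : SimRel C Pd ar par D) (Pr : List (Clause C Pd ar par D)) :
    Set (Clause C (ExtP Pd D) ar (extPar par D) D) :=
  transPS R Pr ∪ transSim R ∪ transPay R Pr

inductive QHL {Pd' : Type} {par' : Pd' → ℕ} (Q : QualDom D)
    (Pr : Set (Clause C Pd' ar par' D)) : Atom C Pd' ar par' → D → Prop where
  | mp (Cl : Clause C Pd' ar par' D) (hCl : Cl ∈ Pr) (θ : Subst C ar) (ds : List D) (d' : D)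
      (hlen : ds.length = Cl.body.length)
      (hprem : ∀ (i : ℕ) (h1 : i < Cl.body.length) (h2 : i < ds.length),
        QHL Q Pr ((Cl.body.get ⟨i, h1⟩).subst θ) (ds.get ⟨i, h2⟩))
      (hd' : d' ≠ ⊥)
      (hle : d' ≤ Q.att Cl.att (infList ds)) :
      QHL Q Pr (Cl.head.subst θ) d'

theorem le_infList_iff {d : D} {l : List D} : d ≤ infList l ↔ ∀ x ∈ l, d ≤ x := by
  induction l with
  | nil => simp [infList]
  | cons a l ih =>
    rw [List.forall_mem_cons, ← ih]
    exact le_inf_iff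

theorem infList_le {x : D} {l : List D} (hx : x ∈ l) : infList l ≤ x :=
  le_infList_iff.1 le_rfl x hx

theorem infList_cons (a : D) (l : List D) : infList (a :: l) = a ⊓ infList l :=
  rfl

theorem infList_append (l l' : List D) : infList (l ++ l') = infList l ⊓ infList l' := by
  induction l with
  | nil => simp [infList]
  | cons a l ih => rw [List.cons_append, infList_cons, infList_cons, ih, inf_assoc]

theorem infList_le_infList_map {α : Type*} {f : α → D} {l : List α} {ds : List D}
    (h : List.Forall₂ (fun x e => e ≤ f x) l ds) : infList ds ≤ infList (l.map f) := by
  induction h with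
  | nil => exact le_rfl
  | cons hx _ ih => exact inf_le_inf hx ih

theorem forall₂_append_left {α β : Type*} {S : α → β → Prop} {l₁ l₂ : List α} {u : List β}
    (h : List.Forall₂ S (l₁ ++ l₂) u) :
    ∃ u₁ u₂, List.Forall₂ S l₁ u₁ ∧ List.Forall₂ S l₂ u₂ ∧ u = u₁ ++ u₂ :=
  ⟨u.take l₁.length, u.drop l₁.length,
    by simpa using List.forall₂_take l₁.length h,
    by simpa using List.forall₂_drop l₁.length h,
    (List.take_append_drop _ _).symm⟩

theorem QualDom.ne_bot_of_le_att (Q : QualDom D) {a b d : D} (hd : d ≠ ⊥)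
    (h : d ≤ Q.att a b) : b ≠ ⊥ := by
  rintro rfl
  rw [Q.att_bot] at h
  exact hd (le_bot_iff.1 h)

theorem QualDom.top_att (Q : QualDom D) (a : D) : Q.att ⊤ a = a := by
  rw [Q.att_comm, Q.att_top]

theorem QHL.of_forall₂ {Pd' : Type} {par' : Pd' → ℕ} {Q : QualDom D}
    {Pr : Set (Clause C Pd' ar par' D)} {Cl : Clause C Pd' ar par' D} (hCl : Cl ∈ Pr)
    (θ : Subst C ar) {ds : List D} {d : D}
    (hprem : List.Forall₂ (fun B e => QHL Q Pr (B.subst θ) e) Cl.body ds)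
    (hd : d ≠ ⊥) (hle : d ≤ Q.att Cl.att (infList ds)) : QHL Q Pr (Cl.head.subst θ) d :=
  .mp Cl hCl θ ds d hprem.length_eq.symm (fun _ h1 h2 => hprem.get h1 h2) hd hle

mutual
  theorem termSim_self (R : SimRel C Pd ar par D) : ∀ t : Term C ar, termSim R t t = ⊤
    | .var i => by simp [termSim]
    | .app c ts => by simp [termSim, R.simC_refl, vecSim_self R ts]
  theorem vecSim_self (R : SimRel C Pd ar par D) :
      ∀ {n : ℕ} (ts : TermVec C ar n), vecSim R ts ts = ⊤
    | _, .nil => by simp [vecSim]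
    | _, .cons t ts => by simp [vecSim, termSim_self R t, vecSim_self R ts]
end

theorem le_vecSim_varVec_subst (R : SimRel C Pd ar par D) (θ : Subst C ar) {d : D} {n : ℕ} :
    ∀ a b : ℕ, (∀ i < n, d ≤ termSim R (θ (a + i)) (θ (b + i))) →
      d ≤ vecSim R ((varVec C ar a n).subst θ) ((varVec C ar b n).subst θ) := by
  induction n with
  | zero => intro a b _; simp [varVec, TermVec.subst, vecSim]
  | succ n ih =>
    intro a b h
    simp only [varVec, TermVec.subst, vecSim, Term.subst]
    refine le_inf (h 0 n.succ_pos) (ih _ _ fun i hi => ?_)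
    have := h (i + 1) (by omega)
    rwa [← add_assoc, ← add_assoc, add_right_comm a, add_right_comm b] at this

def TermVec.get : ∀ {n : ℕ}, TermVec C ar n → ℕ → Term C ar
  | _, .nil, _ => .var 0
  | _, .cons t _, 0 => t
  | _, .cons _ ts, i + 1 => ts.get i

theorem varVec_subst_eq (θ : Subst C ar) : ∀ {n : ℕ} (v : TermVec C ar n) (a : ℕ),
    (∀ i < n, θ (a + i) = v.get i) → (varVec C ar a n).subst θ = v
  | _, .nil, _, _ => by simp [varVec, TermVec.subst]
  | _, .cons t ts, a, h => by
    simp only [varVec, TermVec.subst, Term.subst]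
    congr 1
    · exact h 0 (Nat.succ_pos _)
    · refine varVec_subst_eq θ ts (a + 1) fun i hi => ?_
      rw [add_right_comm]
      exact h (i + 1) (by omega)

theorem QHL.payAtom_of_le {Q : QualDom D} {R : SimRel C Pd ar par D}
    {Pr : List (Clause C Pd ar par D)} {w d : D} (hw : w ∈ payWeights R Pr) (hd : d ≠ ⊥)
    (hle : d ≤ w) : QHL Q (transProg R Pr) (payAtom w) d :=
  QHL.of_forall₂ (Cl := ⟨payAtom w, w, []⟩) (ds := []) (.inr ⟨w, hw, rfl⟩) Term.var .nil hd
    (by simpa [infList, Q.att_top] using hle)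

theorem QHL.simAtom_app {Q : QualDom D} {R : SimRel C Pd ar par D}
    {Pr : List (Clause C Pd ar par D)} {c c' : C} {ts : TermVec C ar (ar c)}
    {ss : TermVec C ar (ar c')} {d : D} (hd : d ≠ ⊥) (hc : d ≤ R.simC c c')
    (h : ∀ i < ar c, QHL Q (transProg R Pr) (simAtom (ts.get i) (ss.get i)) d) :
    QHL Q (transProg R Pr) (simAtom (.app c ts) (.app c' ss)) d := by
  have hc0 : R.simC c c' ≠ ⊥ := ne_bot_of_le_ne_bot hd hc
  have har := R.simC_arity c c' hc0
  let θ : Subst C ar := fun i => if i < ar c then ts.get i else ss.get (i - ar c)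
  have hleft : (varVec C ar 0 (ar c)).subst θ = ts :=
    varVec_subst_eq θ ts 0 fun i hi => by simp [θ, hi]
  have hright : (varVec C ar (ar c) (ar c')).subst θ = ss :=
    varVec_subst_eq θ ss (ar c) fun i _ => by simp [θ]
  have key : QHL Q (transProg R Pr)
      ((simAtom (.app c (varVec C ar 0 (ar c)))
        (.app c' (varVec C ar (ar c) (ar c'))) :
          Atom C (ExtP Pd D) ar (extPar par D)).subst θ) d := by
    refine QHL.of_forall₂ (Pr := transProg R Pr) (ds := d :: (List.range (ar c)).map fun _ => d)
      (Or.inl (Or.inr (Or.inr ⟨c, c', hc0, rfl⟩))) θ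
      (.cons (QHL.payAtom_of_le (.inr ⟨c, c', hc0, rfl⟩) hd hc) ?_) hd ?_
    · rw [simConds, List.forall₂_map_left_iff, List.forall₂_map_right_iff, List.forall₂_same]
      intro i hi
      have hi := List.mem_range.1 hi
      have := h i hi
      simpa [Atom.subst, simAtom, TermVec.subst, Term.subst, θ, hi] using this
    · rw [Q.top_att, le_infList_iff]
      simp
  simpa only [Atom.subst, simAtom, TermVec.subst, Term.subst, hleft, hright] using key

mutual
  theorem QHL.simAtom_of_le {Q : QualDom D} {R : SimRel C Pd ar par D}
      {Pr : List (Clause C Pd ar par D)} {d : D} (hd : d ≠ ⊥) :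
      ∀ t s : Term C ar, d ≤ termSim R t s → QHL Q (transProg R Pr) (simAtom t s) d
    | .var i, .var j, h => by
      by_cases hij : i = j
      · subst hij
        exact QHL.of_forall₂ (Q := Q) (Pr := transProg R Pr)
          (Cl := ⟨simAtom (.var 0) (.var 0), ⊤, []⟩) (ds := []) (Or.inl (Or.inr (Or.inl rfl)))
          (fun _ => .var i) .nil hd (by simp [infList, Q.att_top])
      · simp [termSim, hij, hd] at h
    | .var _, .app _ _, h => by simp [termSim, hd] at h
    | .app _ _, .var _, h => by simp [termSim, hd] at h
    | .app c ts, .app c' ss, h => by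
      simp only [termSim, le_inf_iff] at h
      exact QHL.simAtom_app hd h.1 (QHL.simAtom_get_of_le hd ts ss h.2)
  theorem QHL.simAtom_get_of_le {Q : QualDom D} {R : SimRel C Pd ar par D}
      {Pr : List (Clause C Pd ar par D)} {d : D} (hd : d ≠ ⊥) :
      ∀ {n m : ℕ} (ts : TermVec C ar n) (ss : TermVec C ar m), d ≤ vecSim R ts ss →
        ∀ i < n, QHL Q (transProg R Pr) (simAtom (ts.get i) (ss.get i)) d
    | _, _, .nil, _, _, _, hi => absurd hi (Nat.not_lt_zero _)
    | _, _, .cons _ _, .nil, h, _, _ => by simp [vecSim, hd] at h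
    | _, _, .cons t _, .cons s _, h, 0, _ => by
      simp only [vecSim, le_inf_iff] at h
      exact QHL.simAtom_of_le hd t s h.1
    | _, _, .cons _ ts, .cons _ ss, h, i + 1, hi => by
      simp only [vecSim, le_inf_iff] at h
      exact QHL.simAtom_get_of_le hd ts ss h.2 i (Nat.lt_of_succ_lt_succ hi)
end

theorem SQHL.embed {Q : QualDom D} {R : SimRel C Pd ar par D}
    {Pr : List (Clause C Pd ar par D)} {A : Atom C Pd ar par} {d : D} (h : SQHL R Q Pr A d) :
    QHL Q (transProg R Pr) A.embed d := by
  induction h with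
  | mp Cl hCl Cl' δ ds d hinst hlen _ hd hle ih =>
    obtain ⟨As, θ, hδ, hδ0, rfl⟩ := hinst
    have hhead : δ ≤ atomSim R Cl.linHead.1 As := hδ.le.trans inf_le_left
    have hhead0 : atomSim R Cl.linHead.1 As ≠ ⊥ := ne_bot_of_le_ne_bot hδ0 hhead
    have hconds : ∀ p ∈ Cl.linHead.2, δ ≤ termSim R (θ p.1) (θ p.2) := fun p hp =>
      (hδ.le.trans inf_le_right).trans (infList_le (List.mem_map_of_mem hp))
    refine QHL.of_forall₂ (Pr := transProg R Pr) (ds := δ :: (Cl.linHead.2.map (fun _ => δ) ++ ds))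
      (Or.inl (Or.inl ⟨Cl, hCl, As, hhead0, rfl⟩)) θ
      (.cons (QHL.payAtom_of_le (.inl ⟨Cl, hCl, As, hhead0, rfl⟩) hδ0 hhead)
        (List.rel_append ?_ ?_)) hd ?_
    · rw [condAtoms, List.forall₂_map_left_iff, List.forall₂_map_right_iff, List.forall₂_same]
      exact fun p hp => QHL.simAtom_of_le hδ0 _ _ (hconds p hp)
    · have hbody : List.Forall₂ (fun B e => QHL Q (transProg R Pr) (Atom.embed B) e)
          (Cl.body.map (Atom.subst · θ)) ds := List.forall₂_iff_get.2 ⟨hlen.symm, ih⟩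
      rw [List.forall₂_map_left_iff] at hbody ⊢
      exact hbody
    · refine hle.trans (Q.att_mono _ _ _ _ le_rfl ?_)
      rw [le_infList_iff]
      intro x hx
      rw [List.mem_cons, List.mem_append, List.mem_map] at hx
      rcases hx with rfl | ⟨_, _, rfl⟩ | hx
      · exact inf_le_left
      · exact inf_le_left
      · exact inf_le_right.trans (infList_le hx)

/-- What derivability in the transformed program means for each kind of atom of the enlarged
signature. -/
def TransSound (R : SimRel C Pd ar par D) (Q : QualDom D) (Pr : List (Clause C Pd ar par D)) :
    Atom C (ExtP Pd D) ar (extPar par D) → D → Prop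
  | ⟨.inl p, ts⟩, d => SQHL R Q Pr ⟨p, ts⟩ d
  | ⟨.inr (.inl _), .cons t (.cons s .nil)⟩, d => d ≤ termSim R t s
  | ⟨.inr (.inr w), _⟩, d => d ≤ w

theorem QHL.transSound {Q : QualDom D} {R : SimRel C Pd ar par D}
    {Pr : List (Clause C Pd ar par D)} {A : Atom C (ExtP Pd D) ar (extPar par D)} {d : D}
    (h : QHL Q (transProg R Pr) A d) : TransSound R Q Pr A d := by
  induction h with
  | mp Cl hCl θ ds d hlen _ hd hle ih =>
    have hprem : List.Forall₂ (fun B e => TransSound R Q Pr (B.subst θ) e) Cl.body ds :=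
      List.forall₂_iff_get.2 ⟨hlen.symm, ih⟩
    clear ih hlen
    rcases hCl with (⟨Cl, hCl, As, hhead0, rfl⟩ | rfl | ⟨c, c', hc0, rfl⟩) | ⟨w, hw, rfl⟩
    · obtain ⟨w, es, hpay, hrest, rfl⟩ := List.forall₂_cons_left_iff.1 hprem
      obtain ⟨cs, bs, hcs, hbs, rfl⟩ := forall₂_append_left hrest
      rw [condAtoms, List.forall₂_map_left_iff] at hcs
      have hδ : infList (w :: (cs ++ bs)) ≤
          (atomSim R Cl.linHead.1 As ⊓ condsInf R θ Cl.linHead.2) ⊓ infList bs := by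
        rw [infList_cons, infList_append, ← inf_assoc]
        exact inf_le_inf_right _ (inf_le_inf hpay (infList_le_infList_map hcs))
      rw [List.forall₂_map_left_iff] at hbs
      have hbody : List.Forall₂ (SQHL R Q Pr) (Cl.body.map (Atom.subst · θ)) bs :=
        List.forall₂_map_left_iff.2 hbs
      exact SQHL.mp Cl hCl ⟨As.subst θ, Cl.att, Cl.body.map (Atom.subst · θ)⟩ _ bs d
        ⟨As, θ, rfl, ne_bot_of_le_ne_bot (Q.ne_bot_of_le_att hd hle) (hδ.trans inf_le_left), rfl⟩
        hbody.length_eq.symm (fun _ h1 h2 => hbody.get h1 h2) hd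
        (hle.trans (Q.att_mono _ _ _ _ le_rfl hδ))
    · exact le_top.trans_eq (termSim_self R _).symm
    · obtain ⟨w, es, hpay, hrest, rfl⟩ := List.forall₂_cons_left_iff.1 hprem
      rw [Q.top_att] at hle
      have har := R.simC_arity c c' hc0
      have hargs : d ≤ vecSim R ((varVec C ar 0 (ar c)).subst θ)
          ((varVec C ar (ar c) (ar c')).subst θ) := by
        rw [← har]
        refine le_vecSim_varVec_subst R θ _ _ fun i hi => ?_
        rw [simConds, List.forall₂_map_left_iff] at hrest
        have hes := infList_le_infList_map (f := fun i => termSim R (θ i) (θ (ar c + i))) hrest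
        rw [zero_add]
        rw [infList_cons] at hle
        exact (hle.trans inf_le_right).trans (hes.trans
          (infList_le (List.mem_map_of_mem (List.mem_range.2 hi))))
      change d ≤ termSim R (.app c _) (.app c' _)
      rw [termSim]
      exact le_inf ((hle.trans (infList_le List.mem_cons_self)).trans hpay) hargs
    · exact hle.trans ((Q.att_mono _ _ _ _ le_rfl le_top).trans_eq (Q.att_top _))

/-- Semantic equivalence of an `SQLP(R,D)` program `Pr` and its transformed `QLP(D)`
program `T_R(Pr)`: for every atom `A` of `Pr`'s signature and every `d ≠ ⊥`,
`Pr ⊢_SQHL(R,D) A#d` iff `T_R(Pr) ⊢_QHL(D) A#d`. Consequently, the least Herbrand model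
of `T_R(Pr)` restricted to atoms of `Pr`'s signature coincides with the least Herbrand
model of `Pr`. -/
theorem transProg_equivalence {C Pd : Type} {ar : C → ℕ} {par : Pd → ℕ}
    {D : Type} [Lattice D] [BoundedOrder D] (Q : QualDom D) (R : SimRel C Pd ar par D)
    (Pr : List (Clause C Pd ar par D)) (hPr : ∀ Cl ∈ Pr, Cl.att ≠ ⊥) :
    (∀ (A : Atom C Pd ar par) (d : D), d ≠ ⊥ →
      (SQHL R Q Pr A d ↔ QHL Q (transProg R Pr) (Atom.embed A) d)) ∧
    {p : Atom C Pd ar par × D | p.2 ≠ ⊥ ∧ QHL Q (transProg R Pr) (Atom.embed p.1) p.2} =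
      {p : Atom C Pd ar par × D | p.2 ≠ ⊥ ∧ SQHL R Q Pr p.1 p.2} := by
  have key (A : Atom C Pd ar par) (d : D) :
      SQHL R Q Pr A d ↔ QHL Q (transProg R Pr) (Atom.embed A) d :=
    ⟨SQHL.embed, QHL.transSound⟩
  refine ⟨fun A d _ => key A d, ?_⟩
  ext p
  exact and_congr_right fun _ => (key p.1 p.2).symm
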